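/- For every integer k ≥ 1, the 3-uniform pattern P_k is minimal, i.e., every P_k-optimal vector has all entries strictly positive. -/

import Mathlib

/-- The Lagrange polynomial of a family `E` of `r`-element multisets on `{1, …, m}`:
`λ_E(x) = r! · Σ_{S ∈ E} Π_{i=1}^m x_i^{S(i)} / S(i)!`. -/
noncomputable def lagrangePoly (r m : ℕ) (E : Finset (Multiset ℕ)) (x : ℕ → ℝ) : ℝ :=
  (Nat.factorial r : ℝ) *
    ∑ S ∈ E, ∏ i ∈ Finset.Icc 1 m, x i ^ (S.count i) / (Nat.factorial (S.count i) : ℝ)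

/-- The standard simplex `Δ_{m-1}`, viewed on the coordinates `1, …, m`. -/
def patternSimplex (m : ℕ) : Set (ℕ → ℝ) :=
  {x | (∀ i ∈ Finset.Icc 1 m, 0 ≤ x i ∧ x i ≤ 1) ∧ ∑ i ∈ Finset.Icc 1 m, x i = 1}

/-- The Lagrangian `λ(P)` of the pattern `P = (m, E)` (with uniformity `r`):
the supremum (in fact maximum) of the Lagrange polynomial over the standard simplex. -/
noncomputable def lagrangian (r m : ℕ) (E : Finset (Multiset ℕ)) : ℝ :=
  sSup (lagrangePoly r m E '' patternSimplex m)

/-- A vector is `P`-optimal if it lies in the simplex and attains the Lagrangian. -/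
def IsOptimalVec (r m : ℕ) (E : Finset (Multiset ℕ)) (x : ℕ → ℝ) : Prop :=
  x ∈ patternSimplex m ∧ lagrangePoly r m E x = lagrangian r m E

/-- A pattern is minimal if no `P`-optimal vector has a zero entry. -/
def IsMinimalPattern (r m : ℕ) (E : Finset (Multiset ℕ)) : Prop :=
  ∀ x : ℕ → ℝ, IsOptimalVec r m E x → ∀ i ∈ Finset.Icc 1 m, x i ≠ 0

/-- One step of the recursive construction: given the edge family of `P_k`
(on `{1, …, m-2}`), produce the edge family of `P_{k+1}` on `{1, …, m}`:
all multisets `{1,2,a}` with `3 ≤ a ≤ m`, all multisets `{1,a,b}` and `{2,a,b}` with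
`3 ≤ a ≤ b ≤ m`, together with every multiset of the old family shifted up by `2`. -/
def stepE (m : ℕ) (old : Finset (Multiset ℕ)) : Finset (Multiset ℕ) :=
  ((Finset.Icc 3 m).image fun a => ({1, 2, a} : Multiset ℕ)) ∪
  ((Finset.Icc 3 m ×ˢ Finset.Icc 3 m).image fun p => ({1, p.1, p.2} : Multiset ℕ)) ∪
  ((Finset.Icc 3 m ×ˢ Finset.Icc 3 m).image fun p => ({2, p.1, p.2} : Multiset ℕ)) ∪
  old.image (Multiset.map (· + 2))

/-- `patE k` is the edge family `E_{k+1}` of the 3-uniform pattern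
`P_{k+1} = (2(k+1)+1, E_{k+1})`, so that `patE 0 = E_1 = {{1,2,3},{1,3,3},{2,3,3}}`
on `{1,2,3}`, and `patE (k+1)` on `{1, …, 2k+5}` is obtained from `patE k` by `stepE`. -/
def patE : ℕ → Finset (Multiset ℕ)
  | 0 => {({1, 2, 3} : Multiset ℕ), ({1, 3, 3} : Multiset ℕ), ({2, 3, 3} : Multiset ℕ)}
  | k + 1 => stepE (2 * (k + 1) + 3) (patE k)

open Finset in
theorem lagrangePoly_congr {r m : ℕ} {E : Finset (Multiset ℕ)} {x y : ℕ → ℝ}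
    (h : ∀ i ∈ Icc 1 m, x i = y i) : lagrangePoly r m E x = lagrangePoly r m E y := by
  unfold lagrangePoly
  exact congrArg _ (sum_congr rfl fun S _ => prod_congr rfl fun i hi => by rw [h i hi])

open Finset in
theorem prod_count_cons_of_notMem {m a : ℕ} {S : Multiset ℕ} (x : ℕ → ℝ) (ha : a ∈ Icc 1 m)
    (haS : a ∉ S) :
    ∏ i ∈ Icc 1 m, x i ^ ((a ::ₘ S).count i) / (Nat.factorial ((a ::ₘ S).count i) : ℝ) =
      x a * ∏ i ∈ Icc 1 m, x i ^ (S.count i) / (Nat.factorial (S.count i) : ℝ) := by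
  have h : ∀ i ∈ Icc 1 m,
      x i ^ ((a ::ₘ S).count i) / (Nat.factorial ((a ::ₘ S).count i) : ℝ) =
        (if i = a then x i else 1) * (x i ^ (S.count i) / (Nat.factorial (S.count i) : ℝ)) := by
    intro i _
    by_cases hi : i = a
    · subst hi
      simp [Multiset.count_eq_zero_of_notMem haS]
    · simp [Multiset.count_cons_of_ne hi, hi]
  rw [prod_congr rfl h, prod_mul_distrib, prod_ite_eq' (Icc 1 m) a x, if_pos ha]

open Finset in
theorem prod_count_singleton {m a : ℕ} (x : ℕ → ℝ) (ha : a ∈ Icc 1 m) :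
    ∏ i ∈ Icc 1 m, x i ^ (({a} : Multiset ℕ).count i) /
      (Nat.factorial (({a} : Multiset ℕ).count i) : ℝ) = x a := by
  have h := prod_count_cons_of_notMem x ha (Multiset.notMem_zero a)
  simpa using h

open Finset in
theorem prod_count_pair {m a b : ℕ} (x : ℕ → ℝ) (ha : a ∈ Icc 1 m) (hb : b ∈ Icc 1 m) :
    ∏ i ∈ Icc 1 m, x i ^ (({a, b} : Multiset ℕ).count i) /
      (Nat.factorial (({a, b} : Multiset ℕ).count i) : ℝ) =
      if a = b then x a ^ 2 / 2 else x a * x b := by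
  split_ifs with hab
  · subst hab
    rw [prod_eq_single_of_mem a ha]
    · simp
    · intro i _ hi
      simp [hi]
  · rw [Multiset.insert_eq_cons, prod_count_cons_of_notMem x ha (by simpa using hab),
      prod_count_singleton x hb]

open Finset in
theorem sum_image_pairs {m c n : ℕ} (x : ℕ → ℝ) (hc : c ∈ Icc 1 m) (hcn : c < n) :
    ∑ S ∈ (Icc n m ×ˢ Icc n m).image (fun p => ({c, p.1, p.2} : Multiset ℕ)),
      ∏ i ∈ Icc 1 m, x i ^ (S.count i) / (Nat.factorial (S.count i) : ℝ) =
      x c * (∑ i ∈ Icc n m, x i) ^ 2 / 2 := by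
  have hmaps : ∀ p ∈ Icc n m ×ˢ Icc n m, ({c, p.1, p.2} : Multiset ℕ) ∈
      (Icc n m ×ˢ Icc n m).image (fun p => ({c, p.1, p.2} : Multiset ℕ)) :=
    fun p hp => mem_image_of_mem _ hp
  have hsq : x c * (∑ i ∈ Icc n m, x i) ^ 2 / 2 =
      ∑ p ∈ Icc n m ×ˢ Icc n m, x c * (x p.1 * x p.2) / 2 := by
    rw [sq, sum_mul_sum, ← sum_product', mul_sum, sum_div]
  rw [hsq, ← sum_fiberwise_of_maps_to hmaps]
  refine sum_congr rfl fun S hS => ?_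
  obtain ⟨⟨a, b⟩, hab, rfl⟩ := mem_image.1 hS
  simp only [mem_product, mem_Icc] at hab
  obtain ⟨⟨ha, ha'⟩, hb, hb'⟩ := hab
  have hfiber : (Icc n m ×ˢ Icc n m).filter
      (fun p => ({c, p.1, p.2} : Multiset ℕ) = {c, a, b}) = {(a, b), (b, a)} := by
    ext ⟨p, q⟩
    simp only [mem_filter, mem_product, mem_Icc, mem_insert, mem_singleton, Prod.mk.injEq,
      Multiset.insert_eq_cons, Multiset.cons_inj_right]
    have hpair : (p ::ₘ {q} : Multiset ℕ) = a ::ₘ {b} ↔ (p = a ∧ q = b) ∨ (p = b ∧ q = a) := by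
      simp only [Multiset.cons_eq_cons, Multiset.singleton_eq_cons_iff, Multiset.singleton_inj]
      grind
    rw [hpair]
    constructor
    · exact fun h => h.2
    · rintro (⟨rfl, rfl⟩ | ⟨rfl, rfl⟩) <;> simp [*]
  have hca : c ∉ (a ::ₘ {b} : Multiset ℕ) := by
    simp only [Multiset.mem_cons, Multiset.mem_singleton]; omega
  rw [hfiber]
  simp only [Multiset.insert_eq_cons]
  rw [prod_count_cons_of_notMem x hc hca]
  have h2 := prod_count_pair (m := m) x (a := a) (b := b) (mem_Icc.2 ⟨by omega, ha'⟩)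
    (mem_Icc.2 ⟨by omega, hb'⟩)
  rw [Multiset.insert_eq_cons] at h2
  rw [h2]
  split_ifs with hab
  · subst hab
    simp only [insert_eq_of_mem, mem_singleton, sum_singleton]
    ring
  · rw [sum_pair (by simpa using fun h _ => hab h)]
    ring

open Finset in
theorem sum_image_singletons {m : ℕ} (x : ℕ → ℝ) (hm : 2 ≤ m) :
    ∑ S ∈ (Icc 3 m).image (fun a => ({1, 2, a} : Multiset ℕ)),
      ∏ i ∈ Icc 1 m, x i ^ (S.count i) / (Nat.factorial (S.count i) : ℝ) =
      x 1 * x 2 * ∑ i ∈ Icc 3 m, x i := by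
  rw [sum_image, mul_sum]
  · refine sum_congr rfl fun a ha => ?_
    rw [mem_Icc] at ha
    simp only [Multiset.insert_eq_cons]
    rw [prod_count_cons_of_notMem x (mem_Icc.2 ⟨le_rfl, by omega⟩),
      prod_count_cons_of_notMem x (mem_Icc.2 ⟨by omega, by omega⟩),
      prod_count_singleton x (mem_Icc.2 ⟨by omega, by omega⟩), mul_assoc]
    · simp only [Multiset.mem_singleton]; omega
    · simp only [Multiset.mem_cons, Multiset.mem_singleton]; omega
  · intro a _ b _ h
    simpa [Multiset.insert_eq_cons] using h

open Finset in
theorem Icc_add_two_eq (m : ℕ) :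
    Icc 1 (m + 2) = insert 1 (insert 2 ((Icc 1 m).map (addRightEmbedding 2))) := by
  ext i
  simp only [map_add_right_Icc, mem_insert, mem_Icc]
  omega

open Finset in
theorem sum_Icc_add_two (m : ℕ) (x : ℕ → ℝ) :
    ∑ i ∈ Icc 1 (m + 2), x i = x 1 + x 2 + ∑ i ∈ Icc 1 m, x (i + 2) := by
  rw [Icc_add_two_eq, sum_insert (by simp), sum_insert (by simp), sum_map, ← add_assoc]
  rfl

open Finset in
theorem prod_Icc_add_two (m : ℕ) (x : ℕ → ℝ) :
    ∏ i ∈ Icc 1 (m + 2), x i = x 1 * x 2 * ∏ i ∈ Icc 1 m, x (i + 2) := by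
  rw [Icc_add_two_eq, prod_insert (by simp), prod_insert (by simp), prod_map, ← mul_assoc]
  rfl

open Finset in
theorem sum_Icc_three (m : ℕ) (x : ℕ → ℝ) :
    ∑ i ∈ Icc 3 (m + 2), x i = ∑ i ∈ Icc 1 m, x (i + 2) := by
  rw [show Icc 3 (m + 2) = (Icc 1 m).map (addRightEmbedding 2) by simp, sum_map]
  rfl

open Finset in
theorem sum_image_shift {m : ℕ} {E : Finset (Multiset ℕ)} (x : ℕ → ℝ)
    (hE : ∀ S ∈ E, ∀ i ∈ S, 1 ≤ i) :
    ∑ S ∈ E.image (Multiset.map (· + 2)),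
      ∏ i ∈ Icc 1 (m + 2), x i ^ (S.count i) / (Nat.factorial (S.count i) : ℝ) =
      ∑ S ∈ E, ∏ i ∈ Icc 1 m,
        x (i + 2) ^ (S.count i) / (Nat.factorial (S.count i) : ℝ) := by
  rw [sum_image fun S _ T _ h => Multiset.map_injective (add_left_injective 2) h]
  refine sum_congr rfl fun S hS => ?_
  rw [prod_Icc_add_two]
  have h1 : (S.map (· + 2)).count 1 = 0 := by
    rw [Multiset.count_eq_zero, Multiset.mem_map]; rintro ⟨i, -, hi⟩; omega
  have h2 : (S.map (· + 2)).count 2 = 0 := by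
    rw [Multiset.count_eq_zero, Multiset.mem_map]
    rintro ⟨i, hi, hi'⟩
    have := hE S hS i hi
    omega
  rw [h1, h2]
  simp only [pow_zero, Nat.factorial_zero, Nat.cast_one, div_one, one_mul]
  refine prod_congr rfl fun i _ => ?_
  rw [Multiset.count_map_eq_count' (· + 2) S (add_left_injective 2) i]

open Finset in
theorem lagrangePoly_stepE {m : ℕ} {E : Finset (Multiset ℕ)} (x : ℕ → ℝ)
    (hE : ∀ S ∈ E, ∀ i ∈ S, 1 ≤ i) :
    lagrangePoly 3 (m + 2) (stepE (m + 2) E) x =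
      6 * (x 1 * x 2) * (∑ i ∈ Icc 1 m, x (i + 2)) +
        3 * (x 1 + x 2) * (∑ i ∈ Icc 1 m, x (i + 2)) ^ 2 +
        lagrangePoly 3 m E (fun i => x (i + 2)) := by
  unfold lagrangePoly stepE
  rw [sum_union, sum_union, sum_union, sum_image_singletons x (by omega),
    sum_image_pairs x (mem_Icc.2 ⟨le_rfl, by omega⟩) (by omega),
    sum_image_pairs x (mem_Icc.2 ⟨by omega, by omega⟩) (by omega),
    sum_image_shift x hE, sum_Icc_three]
  · simp only [show Nat.factorial 3 = 6 from rfl]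
    push_cast
    ring
  · rw [disjoint_left]
    intro S hS hS'
    obtain ⟨a, ha, rfl⟩ := mem_image.1 hS
    obtain ⟨p, hp, h⟩ := mem_image.1 hS'
    have h2 : 2 ∈ ({1, p.1, p.2} : Multiset ℕ) := h ▸ by simp
    simp only [mem_product, mem_Icc, Multiset.insert_eq_cons, Multiset.mem_cons,
      Multiset.mem_singleton] at h2 hp
    omega
  · rw [disjoint_left]
    intro S hS hS'
    obtain ⟨p, hp, rfl⟩ := mem_image.1 hS'
    have h1 : 1 ∉ ({2, p.1, p.2} : Multiset ℕ) := by
      simp only [mem_product, mem_Icc, Multiset.insert_eq_cons, Multiset.mem_cons,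
        Multiset.mem_singleton] at hp ⊢
      omega
    refine h1 ?_
    rcases mem_union.1 hS with h | h
    · obtain ⟨a, -, ha⟩ := mem_image.1 h
      exact ha ▸ by simp
    · obtain ⟨a, -, ha⟩ := mem_image.1 h
      exact ha ▸ by simp
  · rw [disjoint_left]
    intro S hS hS'
    obtain ⟨T, hT, rfl⟩ := mem_image.1 hS'
    have hge : ∀ i ∈ T.map (· + 2), 3 ≤ i := by
      intro i hi
      obtain ⟨j, hj, rfl⟩ := Multiset.mem_map.1 hi
      have := hE T hT j hj
      omega
    have h12 : 1 ∈ T.map (· + 2) ∨ 2 ∈ T.map (· + 2) := by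
      rcases mem_union.1 hS with h | h
      · left
        rcases mem_union.1 h with h | h
        · obtain ⟨a, -, ha⟩ := mem_image.1 h
          exact ha ▸ by simp
        · obtain ⟨a, -, ha⟩ := mem_image.1 h
          exact ha ▸ by simp
      · right
        obtain ⟨a, -, ha⟩ := mem_image.1 h
        exact ha ▸ by simp
    rcases h12 with h | h <;> have := hge _ h <;> omega

theorem one_le_of_mem_stepE {m : ℕ} {E : Finset (Multiset ℕ)} :
    ∀ S ∈ stepE m E, ∀ i ∈ S, 1 ≤ i := by
  intro S hS i hi
  simp only [stepE, Finset.mem_union, Finset.mem_image, Finset.mem_product, Finset.mem_Icc] at hS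
  rcases hS with ((⟨a, ha, rfl⟩ | ⟨p, hp, rfl⟩) | ⟨p, hp, rfl⟩) | ⟨T, hT, rfl⟩
  · simp only [Multiset.insert_eq_cons, Multiset.mem_cons, Multiset.mem_singleton] at hi
    omega
  · simp only [Multiset.insert_eq_cons, Multiset.mem_cons, Multiset.mem_singleton] at hi
    omega
  · simp only [Multiset.insert_eq_cons, Multiset.mem_cons, Multiset.mem_singleton] at hi
    omega
  · obtain ⟨j, -, rfl⟩ := Multiset.mem_map.1 hi
    omega

open Finset in
/-- `L` is the maximum of the cubic form `lagrangePoly 3 m E` on the simplex, written in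
homogeneous form, and it is attained only at vectors with positive entries. -/
structure IsStrictMax (m : ℕ) (E : Finset (Multiset ℕ)) (L : ℝ) : Prop where
  le : ∀ x : ℕ → ℝ, (∀ i ∈ Icc 1 m, 0 ≤ x i) →
    lagrangePoly 3 m E x ≤ L * (∑ i ∈ Icc 1 m, x i) ^ 3
  pos : ∀ x : ℕ → ℝ, (∀ i ∈ Icc 1 m, 0 ≤ x i) → 0 < ∑ i ∈ Icc 1 m, x i →
    lagrangePoly 3 m E x = L * (∑ i ∈ Icc 1 m, x i) ^ 3 → ∀ i ∈ Icc 1 m, 0 < x i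
  attained : ∀ s : ℝ, 0 ≤ s → ∃ x : ℕ → ℝ, (∀ i ∈ Icc 1 m, 0 ≤ x i) ∧
    ∑ i ∈ Icc 1 m, x i = s ∧ lagrangePoly 3 m E x = L * s ^ 3

theorem isStrictMax_empty : IsStrictMax 1 ∅ 0 where
  le x _ := by simp [lagrangePoly]
  pos x _ hs _ i hi := by
    obtain rfl : i = 1 := by simpa using hi
    simpa using hs
  attained s hs := ⟨fun _ => s, fun _ _ => hs, by simp, by simp [lagrangePoly]⟩

theorem step_gap_eq {c L a b y : ℝ} (hc : c ^ 2 * (3 - 2 * L) = 1) (hc0 : 0 < c) :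
    c * (a + b + y) ^ 3 - (6 * (a * b) * y + 3 * (a + b) * y ^ 2 + L * y ^ 3) =
      (y - c * (a + b + y)) ^ 2 * (y + 2 * (c * (a + b + y))) / (2 * c ^ 2) +
        3 / 2 * (a - b) ^ 2 * y := by
  obtain rfl : L = 3 / 2 - 1 / (2 * c ^ 2) := by
    field_simp
    linarith
  field_simp
  ring

open Finset in
theorem IsStrictMax.stepE {m : ℕ} {E : Finset (Multiset ℕ)} {L c : ℝ} (h : IsStrictMax m E L)
    (hE : ∀ S ∈ E, ∀ i ∈ S, 1 ≤ i) (hc : c ^ 2 * (3 - 2 * L) = 1) (hc0 : 0 < c) (hc1 : c < 1) :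
    IsStrictMax (m + 2) (stepE (m + 2) E) c := by
  have hmem : ∀ i ∈ Icc 1 m, i + 2 ∈ Icc 1 (m + 2) := fun i hi => by
    rw [mem_Icc] at hi ⊢; omega
  have h1m : 1 ∈ Icc 1 (m + 2) := mem_Icc.2 ⟨le_rfl, by omega⟩
  have h2m : 2 ∈ Icc 1 (m + 2) := mem_Icc.2 ⟨by omega, by omega⟩
  refine ⟨fun x hx => ?_, fun x hx hs heq => ?_, fun s hs => ?_⟩
  · have hx' : ∀ i ∈ Icc 1 m, 0 ≤ x (i + 2) := fun i hi => hx _ (hmem i hi)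
    have hle := h.le _ hx'
    rw [lagrangePoly_stepE x hE, sum_Icc_add_two]
    have hy : 0 ≤ ∑ i ∈ Icc 1 m, x (i + 2) := sum_nonneg hx'
    set y := ∑ i ∈ Icc 1 m, x (i + 2)
    have ha := hx 1 h1m
    have hb := hx 2 h2m
    have hgap := step_gap_eq (a := x 1) (b := x 2) (y := y) hc hc0
    have : 0 ≤ (y - c * (x 1 + x 2 + y)) ^ 2 * (y + 2 * (c * (x 1 + x 2 + y))) / (2 * c ^ 2) +
        3 / 2 * (x 1 - x 2) ^ 2 * y := by positivity
    linarith
  · have hx' : ∀ i ∈ Icc 1 m, 0 ≤ x (i + 2) := fun i hi => hx _ (hmem i hi)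
    have hle := h.le _ hx'
    have hpos := h.pos _ hx'
    rw [lagrangePoly_stepE x hE, sum_Icc_add_two] at heq
    rw [sum_Icc_add_two] at hs
    have hy : 0 ≤ ∑ i ∈ Icc 1 m, x (i + 2) := sum_nonneg hx'
    set y := ∑ i ∈ Icc 1 m, x (i + 2)
    have ha := hx 1 h1m
    have hb := hx 2 h2m
    have hgap := step_gap_eq (a := x 1) (b := x 2) (y := y) hc hc0
    have hcs : 0 < c * (x 1 + x 2 + y) := mul_pos hc0 hs
    have hA : 0 ≤ (y - c * (x 1 + x 2 + y)) ^ 2 * (y + 2 * (c * (x 1 + x 2 + y))) /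
        (2 * c ^ 2) := by positivity
    have hB : 0 ≤ 3 / 2 * (x 1 - x 2) ^ 2 * y := by positivity
    have hA0 : (y - c * (x 1 + x 2 + y)) ^ 2 * (y + 2 * (c * (x 1 + x 2 + y))) /
        (2 * c ^ 2) = 0 := by linarith
    have hB0 : 3 / 2 * (x 1 - x 2) ^ 2 * y = 0 := by linarith
    have hyc : y = c * (x 1 + x 2 + y) := by
      have h2 : y + 2 * (c * (x 1 + x 2 + y)) ≠ 0 := by positivity
      have h3 : 2 * c ^ 2 ≠ 0 := by positivity
      simpa [h2, h3, hc0.ne', sub_eq_zero] using hA0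
    have hy0 : 0 < y := hyc ▸ hcs
    have hab : x 1 = x 2 := by
      simpa [hy0.ne', sub_eq_zero] using hB0
    have hys : y < x 1 + x 2 + y := by nlinarith
    intro i hi
    have hi' := mem_Icc.1 hi
    rcases (by omega : i = 1 ∨ i = 2 ∨ 3 ≤ i) with rfl | rfl | h3
    · linarith
    · linarith
    · obtain ⟨j, rfl⟩ : ∃ j, i = j + 2 := ⟨i - 2, by omega⟩
      exact hpos hy0 (by linarith) j (mem_Icc.2 (by omega))
  · obtain ⟨z, hz, hzs, hzL⟩ := h.attained (c * s) (by positivity)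
    have hhalf : 0 ≤ (1 - c) * s / 2 := by
      have : 0 ≤ 1 - c := by linarith
      positivity
    obtain ⟨x, hx1, hx2, hxz⟩ : ∃ x : ℕ → ℝ, x 1 = (1 - c) * s / 2 ∧ x 2 = (1 - c) * s / 2 ∧
        ∀ i ∈ Icc 1 m, x (i + 2) = z i := by
      refine ⟨fun i => if i ≤ 2 then (1 - c) * s / 2 else z (i - 2), by simp, by simp,
        fun i hi => ?_⟩
      have := mem_Icc.1 hi
      simp [show i ≠ 0 by omega]
    have hy : ∑ i ∈ Icc 1 m, x (i + 2) = c * s := by rw [sum_congr rfl hxz, hzs]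
    have hs' : (1 - c) * s / 2 + (1 - c) * s / 2 + c * s = s := by ring
    refine ⟨x, fun i hi => ?_, ?_, ?_⟩
    · have hi' := mem_Icc.1 hi
      rcases (by omega : i = 1 ∨ i = 2 ∨ 3 ≤ i) with rfl | rfl | h3
      · rwa [hx1]
      · rwa [hx2]
      · obtain ⟨j, rfl⟩ : ∃ j, i = j + 2 := ⟨i - 2, by omega⟩
        have hj : j ∈ Icc 1 m := mem_Icc.2 (by omega)
        rw [hxz j hj]
        exact hz j hj
    · rw [sum_Icc_add_two, hx1, hx2, hy, hs']
    · have hgap := step_gap_eq (a := (1 - c) * s / 2) (b := (1 - c) * s / 2) (y := c * s) hc hc0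
      rw [hs', sub_self, sub_self, zero_pow two_ne_zero, zero_mul, zero_div, mul_zero, zero_mul,
        add_zero, sub_eq_zero] at hgap
      rw [lagrangePoly_stepE x hE, hx1, hx2, hy, lagrangePoly_congr hxz, hzL, hgap]

theorem exists_isStrictMax_stepE {m : ℕ} {E : Finset (Multiset ℕ)}
    (hE : ∀ S ∈ E, ∀ i ∈ S, 1 ≤ i) (h : ∃ L < 1, IsStrictMax m E L) :
    ∃ L < 1, IsStrictMax (m + 2) (stepE (m + 2) E) L := by
  obtain ⟨L, hL, hmax⟩ := h
  have hpos : 0 < 3 - 2 * L := by linarith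
  have hsqrt : 1 < √(3 - 2 * L) := Real.lt_sqrt_of_sq_lt (by linarith)
  refine ⟨(√(3 - 2 * L))⁻¹, inv_lt_one_of_one_lt₀ hsqrt,
    hmax.stepE hE ?_ (inv_pos.2 (by linarith)) (inv_lt_one_of_one_lt₀ hsqrt)⟩
  rw [inv_pow, Real.sq_sqrt hpos.le, inv_mul_cancel₀ hpos.ne']

theorem patE_zero : patE 0 = stepE 3 ∅ := by decide

theorem one_le_of_mem_patE (k : ℕ) : ∀ S ∈ patE k, ∀ i ∈ S, 1 ≤ i := by
  cases k with
  | zero => rw [patE_zero]; exact one_le_of_mem_stepE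
  | succ k => exact one_le_of_mem_stepE

theorem exists_isStrictMax_patE (k : ℕ) : ∃ L < 1, IsStrictMax (2 * k + 3) (patE k) L := by
  induction k with
  | zero =>
    rw [patE_zero]
    exact exists_isStrictMax_stepE (by simp) ⟨0, one_pos, isStrictMax_empty⟩
  | succ k ih => exact exists_isStrictMax_stepE (one_le_of_mem_patE k) ih

theorem IsStrictMax.lagrangian_eq {m : ℕ} {E : Finset (Multiset ℕ)} {L : ℝ}
    (h : IsStrictMax m E L) : lagrangian 3 m E = L := by
  refine IsGreatest.csSup_eq ⟨?_, ?_⟩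
  · obtain ⟨x, hx, hs, hL⟩ := h.attained 1 zero_le_one
    refine ⟨x, ⟨fun i hi => ⟨hx i hi, ?_⟩, hs⟩, by simpa using hL⟩
    exact hs ▸ Finset.single_le_sum hx hi
  · rintro _ ⟨x, ⟨hx, hs⟩, rfl⟩
    simpa [hs] using h.le x fun i hi => (hx i hi).1

theorem IsStrictMax.pos_of_isOptimalVec {m : ℕ} {E : Finset (Multiset ℕ)} {L : ℝ}
    (h : IsStrictMax m E L) {x : ℕ → ℝ} (hx : IsOptimalVec 3 m E x) :
    ∀ i ∈ Finset.Icc 1 m, 0 < x i := by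
  obtain ⟨⟨hx, hs⟩, hopt⟩ := hx
  exact h.pos x (fun i hi => (hx i hi).1) (by simp [hs]) (by simp [hs, hopt, h.lagrangian_eq])

/-- For every integer `k ≥ 1`, the 3-uniform pattern `P_k` is minimal: every `P_k`-optimal
vector has all entries strictly positive (here `patE k` is the edge family of `P_{k+1}`,
a pattern on `{1, …, 2(k+1)+1}`, so the claim is stated for `patE k` for all `k : ℕ`). -/
theorem patE_minimal (k : ℕ) :
    IsMinimalPattern 3 (2 * k + 3) (patE k) ∧
    ∀ x : ℕ → ℝ, IsOptimalVec 3 (2 * k + 3) (patE k) x →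
      ∀ i ∈ Finset.Icc 1 (2 * k + 3), 0 < x i := by
  obtain ⟨L, -, h⟩ := exists_isStrictMax_patE k
  exact ⟨fun x hx i hi => (h.pos_of_isOptimalVec hx i hi).ne',
    fun x hx => h.pos_of_isOptimalVec hx⟩
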